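/- arXiv:2509.24790 — 3 statements merged into one kernel-verified Lean document; each statement's English description precedes it below -/
import Mathlib

section
/- Let R be a commutative ring, I a finite set, a : I → R, and let i, j ∈ I be two distinct elements. Then for every integer n ≥ 1 the elementary symmetric polynomials satisfy e_{n−2}(a on I∖{i,j}) · e_n(a on I) = e_{n−1}(a on I∖{i}) · e_{n−1}(a on I∖{j}) + e_n(a on I∖{i,j}) · e_{n−2}(a on I∖{i,j}) − (e_{n−1}(a on I∖{i,j}))². -/
/-- Elementary symmetric polynomial of the family `a` over the finite index set `s`,
with integer degree `n`: `e_0 = 1`, `e_n = 0` for `n < 0` or `n > |s|`. -/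
def esymmZ {ι R : Type*} [CommRing R] (s : Finset ι) (a : ι → R) (n : ℤ) : R :=
  if 0 ≤ n then ∑ t ∈ s.powersetCard n.toNat, ∏ i ∈ t, a i else 0

/-- Recurrence obtained by splitting off one element of the index set. -/
theorem esymmZ_insert {ι R : Type*} [CommRing R] [DecidableEq ι] {s : Finset ι} {i : ι}
    (hi : i ∉ s) (a : ι → R) (n : ℤ) :
    esymmZ (insert i s) a n = esymmZ s a n + a i * esymmZ s a (n - 1) := by
  rcases lt_trichotomy n 0 with hn | rfl | hn
  · simp [esymmZ, show ¬ 0 ≤ n by lia, show ¬ 1 ≤ n by lia]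
  · simp [esymmZ]
  · obtain ⟨m, rfl⟩ : ∃ m : ℕ, n = m + 1 := ⟨(n - 1).toNat, by lia⟩
    have hmem : ∀ t ∈ s.powersetCard m, i ∉ t := fun t ht hit =>
      hi ((Finset.mem_powersetCard.1 ht).1 hit)
    have hdisj : Disjoint (s.powersetCard (m + 1)) ((s.powersetCard m).image (insert i)) := by
      rw [Finset.disjoint_left]
      intro t ht ht'
      obtain ⟨u, -, rfl⟩ := Finset.mem_image.1 ht'
      exact hi ((Finset.mem_powersetCard.1 ht).1 (Finset.mem_insert_self i u))
    have hinj : Set.InjOn (insert i) (s.powersetCard m : Set (Finset ι)) := by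
      intro t ht u hu h
      rw [← Finset.erase_insert (hmem t ht), ← Finset.erase_insert (hmem u hu), h]
    have hpos : (0 : ℤ) ≤ m + 1 := by lia
    have htoNat : ((m : ℤ) + 1).toNat = m + 1 := by lia
    simp only [esymmZ, hpos, htoNat, add_sub_cancel_right, Int.natCast_nonneg, Int.toNat_natCast,
      if_true]
    rw [Finset.powersetCard_succ_insert hi, Finset.sum_union hdisj, Finset.sum_image hinj,
      Finset.mul_sum]
    exact congrArg _ (Finset.sum_congr rfl fun t ht => Finset.prod_insert (hmem t ht))

/-- For distinct `i, j ∈ I` and every integer `n ≥ 1`: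
`e_{n-2}^{i,j} · e_n = e_{n-1}^{i} · e_{n-1}^{j} + e_n^{i,j} · e_{n-2}^{i,j} − (e_{n-1}^{i,j})²`. -/
theorem esymm_offdiag_identity {ι R : Type*} [CommRing R] [DecidableEq ι]
    (I : Finset ι) (a : ι → R) (i j : ι) (hi : i ∈ I) (hj : j ∈ I) (hij : i ≠ j)
    (n : ℤ) (hn : 1 ≤ n) :
    esymmZ ((I.erase i).erase j) a (n - 2) * esymmZ I a n
      = esymmZ (I.erase i) a (n - 1) * esymmZ (I.erase j) a (n - 1)
        + esymmZ ((I.erase i).erase j) a n * esymmZ ((I.erase i).erase j) a (n - 2)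
        - (esymmZ ((I.erase i).erase j) a (n - 1)) ^ 2 := by
  have hI : I = insert i (I.erase i) := (Finset.insert_erase hi).symm
  have hIi : I.erase i = insert j ((I.erase i).erase j) :=
    (Finset.insert_erase (Finset.mem_erase.2 ⟨hij.symm, hj⟩)).symm
  have hIj : I.erase j = insert i ((I.erase i).erase j) := by
    rw [Finset.erase_right_comm, Finset.insert_erase (Finset.mem_erase.2 ⟨hij, hi⟩)]
  have hjT : j ∉ (I.erase i).erase j := Finset.notMem_erase _ _
  have hiT : i ∉ (I.erase i).erase j := by simp
  have recI (k : ℤ) : esymmZ I a k = esymmZ (I.erase i) a k + a i * esymmZ (I.erase i) a (k - 1) :=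
    (congrArg (esymmZ · a k) hI).trans (esymmZ_insert (Finset.notMem_erase i I) a k)
  have recIi (k : ℤ) : esymmZ (I.erase i) a k = esymmZ ((I.erase i).erase j) a k
      + a j * esymmZ ((I.erase i).erase j) a (k - 1) :=
    (congrArg (esymmZ · a k) hIi).trans (esymmZ_insert hjT a k)
  have recIj (k : ℤ) : esymmZ (I.erase j) a k = esymmZ ((I.erase i).erase j) a k
      + a i * esymmZ ((I.erase i).erase j) a (k - 1) :=
    (congrArg (esymmZ · a k) hIj).trans (esymmZ_insert hiT a k)
  rw [recI, recIi n, recIi (n - 1), recIj (n - 1), show n - 1 - 1 = n - 2 by ring]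
  ring
end

section
/- Let V be a real inner product space, let α, β ∈ V with β ≠ 0 and ⟨α,β⟩ ∈ {1, −1}, let ε ∈ {1, −1}, and set γ = ε·σ_β α. Then for every x ∈ V one has ⟨α,β⟩·⟨x,α⟩ + ⟨β,γ⟩·⟨x,γ⟩ = 2⟨x,β⟩/⟨β,β⟩. -/
open RealInnerProductSpace

/-- The reflection of `z` along `y`: `σ_y z = z − 2(⟨y,z⟩/⟨y,y⟩)·y`. -/
noncomputable def reflectAlong {V : Type*} [NormedAddCommGroup V] [InnerProductSpace ℝ V]
    (y z : V) : V :=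
  z - (2 * ⟪y, z⟫ / ⟪y, y⟫) • y

theorem inner_reflectAlong_right {V : Type*} [NormedAddCommGroup V] [InnerProductSpace ℝ V]
    (x y z : V) :
    ⟪x, reflectAlong y z⟫ = ⟪x, z⟫ - 2 * ⟪y, z⟫ / ⟪y, y⟫ * ⟪x, y⟫ := by
  rw [reflectAlong, inner_sub_right, real_inner_smul_right]

theorem inner_self_reflectAlong {V : Type*} [NormedAddCommGroup V] [InnerProductSpace ℝ V]
    {y : V} (hy : y ≠ 0) (z : V) : ⟪y, reflectAlong y z⟫ = -⟪y, z⟫ := by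
  rw [inner_reflectAlong_right, div_mul_cancel₀ _ (inner_self_ne_zero.mpr hy)]
  ring

/-- If `β ≠ 0`, `⟨α,β⟩ = ±1`, `ε = ±1` and `γ = ε·σ_β α`, then
`⟨α,β⟩⟨x,α⟩ + ⟨β,γ⟩⟨x,γ⟩ = 2⟨x,β⟩/⟨β,β⟩` for every `x`. -/
theorem reflection_identity_one {V : Type*} [NormedAddCommGroup V] [InnerProductSpace ℝ V]
    (α β : V) (hβ : β ≠ 0) (hαβ : ⟪α, β⟫ = 1 ∨ ⟪α, β⟫ = -1)
    (ε : ℝ) (hε : ε = 1 ∨ ε = -1) (γ : V) (hγ : γ = ε • reflectAlong β α) (x : V) :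
    ⟪α, β⟫ * ⟪x, α⟫ + ⟪β, γ⟫ * ⟪x, γ⟫ = 2 * ⟪x, β⟫ / ⟪β, β⟫ := by
  have hε_sq : ε ^ 2 = 1 := by rcases hε with h | h <;> simp [h]
  have hαβ_sq : ⟪α, β⟫ ^ 2 = 1 := by rcases hαβ with h | h <;> simp [h]
  rw [hγ, real_inner_smul_right, real_inner_smul_right, inner_self_reflectAlong hβ,
    inner_reflectAlong_right, real_inner_comm α β]
  linear_combination (-⟪α, β⟫ * (⟪x, α⟫ - 2 * ⟪α, β⟫ / ⟪β, β⟫ * ⟪x, β⟫)) * hε_sq +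
    2 * ⟪x, β⟫ / ⟪β, β⟫ * hαβ_sq
end

section
/- Let V be a real inner product space, let α, β ∈ V with β ≠ 0 and ⟨α,β⟩ ∈ {1, −1}, and set γ = σ_β α. Then for every x ∈ V and all real numbers p and q one has ⟨α,β⟩·⟨x,α⟩·(⟨x,γ⟩²·q + p) + ⟨β,γ⟩·⟨x,γ⟩·(⟨x,α⟩²·q + p) = (2⟨x,β⟩/⟨β,β⟩)·(p + ⟨α,β⟩⟨β,γ⟩⟨x,α⟩⟨x,γ⟩·q). -/
open RealInnerProductSpace

theorem inner_reflectAlong {V : Type*} [NormedAddCommGroup V] [InnerProductSpace ℝ V]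
    (x y z : V) : ⟪x, reflectAlong y z⟫ = ⟪x, z⟫ - ⟪y, z⟫ * (2 * ⟪x, y⟫ / ⟪y, y⟫) := by
  rw [reflectAlong, inner_sub_right, real_inner_smul_right]
  ring

/-- If `β ≠ 0`, `⟨α,β⟩ = ±1` and `γ = σ_β α`, then for every `x` and all reals `p, q`:
`⟨α,β⟩⟨x,α⟩(⟨x,γ⟩²q + p) + ⟨β,γ⟩⟨x,γ⟩(⟨x,α⟩²q + p)
  = (2⟨x,β⟩/⟨β,β⟩)(p + ⟨α,β⟩⟨β,γ⟩⟨x,α⟩⟨x,γ⟩q)`. -/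
theorem reflection_identity_four {V : Type*} [NormedAddCommGroup V] [InnerProductSpace ℝ V]
    (α β : V) (hβ : β ≠ 0) (hαβ : ⟪α, β⟫ = 1 ∨ ⟪α, β⟫ = -1)
    (γ : V) (hγ : γ = reflectAlong β α) (x : V) (p q : ℝ) :
    ⟪α, β⟫ * ⟪x, α⟫ * (⟪x, γ⟫ ^ 2 * q + p) + ⟪β, γ⟫ * ⟪x, γ⟫ * (⟪x, α⟫ ^ 2 * q + p)
      = (2 * ⟪x, β⟫ / ⟪β, β⟫) * (p + ⟪α, β⟫ * ⟪β, γ⟫ * ⟪x, α⟫ * ⟪x, γ⟫ * q) := by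
  have hβγ : ⟪β, γ⟫ = -⟪α, β⟫ := by
    rw [hγ, inner_self_reflectAlong hβ, real_inner_comm]
  have hxγ : ⟪x, γ⟫ = ⟪x, α⟫ - ⟪α, β⟫ * (2 * ⟪x, β⟫ / ⟪β, β⟫) := by
    rw [hγ, inner_reflectAlong, real_inner_comm β α]
  rw [hβγ, hxγ]
  rcases hαβ with h | h <;> rw [h] <;> ring
end
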